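/- arXiv:1105.0118 — 4 statements merged into one kernel-verified Lean document; each statement's English description precedes it below -/
import Mathlib

section
/- Let ε > 0 and μ > 0, and suppose φ : ℝ → ℝ is four times continuously differentiable on [-1,1], satisfies φ''''(x) = μ·φ(x) for all x ∈ [-1,1], φ(x) > 0 for all x ∈ (-1,1), and the clamped boundary conditions φ(1) = φ(-1) = φ'(1) = φ'(-1) = 0. If ε²·μ < 27/4, then there is no four times continuously differentiable function u : ℝ → ℝ with u(x) > -1 for all x ∈ [-1,1], satisfying ε²·u''''(x) + 1/(1+u(x))² = 0 for all x ∈ [-1,1] and the clamped boundary conditions u(1) = u(-1) = u'(1) = u'(-1) = 0. -/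
/-- On a set of unique differentiability, the iterated derivative of order `k < n` of a `C^n`
function has the next iterated derivative as its derivative. -/
theorem ContDiffOn.hasDerivWithinAt_iteratedDerivWithin {f : ℝ → ℝ} {s : Set ℝ} {n k : ℕ}
    (hf : ContDiffOn ℝ n f s) (hs : UniqueDiffOn ℝ s) (hk : k < n) {x : ℝ} (hx : x ∈ s) :
    HasDerivWithinAt (iteratedDerivWithin k f s) (iteratedDerivWithin (k + 1) f s x) s x := by
  rw [iteratedDerivWithin_succ]
  exact ((hf.differentiableOn_iteratedDerivWithin (by exact_mod_cast hk) hs) x hx).hasDerivWithinAt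

/-- The boundary form of the fourth derivative: its derivative is
`f g - f g`. -/
theorem hasDerivWithinAt_biharmonic_boundary_form {f g : ℝ → ℝ} {s : Set ℝ}
    (hf : ContDiffOn ℝ 4 f s) (hg : ContDiffOn ℝ 4 g s) (hs : UniqueDiffOn ℝ s)
    {x : ℝ} (hx : x ∈ s) :
    HasDerivWithinAt
      (fun y => iteratedDerivWithin 3 f s y * g y
        - iteratedDerivWithin 2 f s y * iteratedDerivWithin 1 g s y
        + iteratedDerivWithin 1 f s y * iteratedDerivWithin 2 g s y
        - f y * iteratedDerivWithin 3 g s y)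
      (iteratedDerivWithin 4 f s x * g x - f x * iteratedDerivWithin 4 g s x) s x := by
  have hF (k : ℕ) (hk : k < 4) :=
    ContDiffOn.hasDerivWithinAt_iteratedDerivWithin (n := 4) hf hs hk hx
  have hG (k : ℕ) (hk : k < 4) :=
    ContDiffOn.hasDerivWithinAt_iteratedDerivWithin (n := 4) hg hs hk hx
  have hf0 := hF 0 (by norm_num)
  have hg0 := hG 0 (by norm_num)
  simp only [iteratedDerivWithin_zero, zero_add] at hf0 hg0
  refine (((((hF 3 (by norm_num)).mul hg0).sub
    ((hF 2 (by norm_num)).mul (hG 1 (by norm_num)))).add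
    ((hF 1 (by norm_num)).mul (hG 2 (by norm_num)))).sub
    (hf0.mul (hG 3 (by norm_num)))).congr_deriv ?_
  norm_num
  ring

/-- Below the critical value `27/4`, the reaction term `c v + 1/(1+v)²` is positive. -/
theorem mul_add_one_div_one_add_sq_pos {c v : ℝ} (hc0 : 0 ≤ c) (hc : c < 27 / 4) (hv : -1 < v) :
    0 < c * v + 1 / (1 + v) ^ 2 := by
  have h1 : 0 < 1 + v := by linarith
  have h2 : 0 < (1 + v) ^ 2 := by positivity
  have key : 0 < c * v * (1 + v) ^ 2 + 1 := by
    rcases le_or_gt 0 v with h | h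
    · positivity
    · have hpos : 0 < -v * (1 + v) ^ 2 := mul_pos (by linarith) h2
      have hcube : 0 ≤ (v + 1 / 3) ^ 2 * (v + 4 / 3) := mul_nonneg (sq_nonneg _) (by linarith)
      nlinarith [mul_lt_mul_of_pos_right hc hpos]
  have heq : c * v + 1 / (1 + v) ^ 2 = (c * v * (1 + v) ^ 2 + 1) / (1 + v) ^ 2 := by
    field_simp
  rw [heq]
  exact div_pos key h2


/-- Nonexistence of equilibrium solutions of the MEMS equation
`ε² u'''' + 1/(1+u)² = 0` on the strip `[-1,1]` with clamped boundary
conditions, given a positive clamped biharmonic eigenpair `(φ, μ)` with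
`ε² μ < 27/4`. -/
theorem no_equilibrium_clamped (ε μ : ℝ) (hε : 0 < ε) (hμ : 0 < μ)
    (φ : ℝ → ℝ)
    (hφC : ContDiffOn ℝ 4 φ (Set.Icc (-1) 1))
    (hφeq : ∀ x ∈ Set.Icc (-1 : ℝ) 1,
      iteratedDerivWithin 4 φ (Set.Icc (-1) 1) x = μ * φ x)
    (hφpos : ∀ x ∈ Set.Ioo (-1 : ℝ) 1, 0 < φ x)
    (hφ1 : φ 1 = 0) (hφm1 : φ (-1) = 0)
    (hφ'1 : derivWithin φ (Set.Icc (-1) 1) 1 = 0)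
    (hφ'm1 : derivWithin φ (Set.Icc (-1) 1) (-1) = 0)
    (hεμ : ε ^ 2 * μ < 27 / 4) :
    ¬ ∃ u : ℝ → ℝ,
      ContDiffOn ℝ 4 u (Set.Icc (-1) 1) ∧
      (∀ x ∈ Set.Icc (-1 : ℝ) 1, -1 < u x) ∧
      (∀ x ∈ Set.Icc (-1 : ℝ) 1,
        ε ^ 2 * iteratedDerivWithin 4 u (Set.Icc (-1) 1) x
          + 1 / (1 + u x) ^ 2 = 0) ∧
      u 1 = 0 ∧ u (-1) = 0 ∧
      derivWithin u (Set.Icc (-1) 1) 1 = 0 ∧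
      derivWithin u (Set.Icc (-1) 1) (-1) = 0 := by
  rintro ⟨u, huC, hu, hueq, hu1, hum1, hu'1, hu'm1⟩
  have hs : UniqueDiffOn ℝ (Set.Icc (-1 : ℝ) 1) := uniqueDiffOn_Icc (by norm_num)
  have hW := fun x (hx : x ∈ Set.Icc (-1 : ℝ) 1) =>
    hasDerivWithinAt_biharmonic_boundary_form huC hφC hs hx
  have hanti := strictAntiOn_of_hasDerivWithinAt_neg (convex_Icc (-1 : ℝ) 1)
    (fun x hx => (hW x hx).continuousWithinAt)
    (fun x hx => (hW x (interior_subset hx)).mono interior_subset)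
    (fun x hx => by
      have hx' := interior_subset hx
      rw [interior_Icc] at hx
      have hpos := mul_pos (hφpos x hx)
        (mul_add_one_div_one_add_sq_pos (by positivity) hεμ (hu x hx'))
      rw [hφeq x hx']
      have heq := hueq x hx'
      have hε2 : 0 < ε ^ 2 := by positivity
      refine neg_of_mul_neg_right (a := ε ^ 2) ?_ hε2.le
      linear_combination hpos + φ x * heq)
  have hlt := hanti (Set.left_mem_Icc.2 (by norm_num)) (Set.right_mem_Icc.2 (by norm_num))
    (show (-1 : ℝ) < 1 by norm_num)
  simp [iteratedDerivWithin_one, hφ1, hφm1, hφ'1, hφ'm1, hu1, hum1, hu'1, hu'm1] at hlt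
end

section
/- For every real number a with 0 ≤ a < 27/4 and every real number u with u > -1, one has a·u + 1/(1+u)² > 0. -/
/-- The scalar inequality behind nonexistence of MEMS equilibria:
for `0 ≤ a < 27/4` and `u > -1`, `a·u + 1/(1+u)² > 0`. -/
theorem scalar_positivity (a u : ℝ) (ha0 : 0 ≤ a) (ha1 : a < 27 / 4)
    (hu : -1 < u) :
    0 < a * u + 1 / (1 + u) ^ 2 := by
  have ht : 0 < 1 + u := by linarith
  have hcubic : -(4 / 27) ≤ u * (1 + u) ^ 2 := by
    have h : 0 ≤ (1 + u - 2 / 3) ^ 2 * (1 + u + 1 / 3) := by positivity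
    linarith
  have hnum : 0 < a * u * (1 + u) ^ 2 + 1 := by
    have h := mul_le_mul_of_nonneg_left hcubic ha0
    linarith
  have heq : a * u + 1 / (1 + u) ^ 2 = (a * u * (1 + u) ^ 2 + 1) / (1 + u) ^ 2 := by
    field_simp
  rw [heq]
  positivity
end

section
/- Let a be a real number with 0 ≤ a < 27/4 and T > 0, and let F : [0,T) → ℝ be differentiable with F(0) = 0, F(t) > -1 for all t ∈ [0,T), and F'(t) = -a·F(t) - 1/(1+F(t))² for all t ∈ [0,T). Then T ≤ ∫_{-1}^{0} ds/(a·s + 1/(1+s)²). -/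
theorem one_add_mul_mul_sq_pos {a s : ℝ} (ha0 : 0 ≤ a) (ha1 : a < 27 / 4) (hs : -(4 / 3) < s) :
    0 < 1 + a * s * (1 + s) ^ 2 := by
  have h : 0 ≤ a * ((s + 1 / 3) ^ 2 * (s + 4 / 3)) :=
    mul_nonneg ha0 (mul_nonneg (sq_nonneg _) (by linarith))
  nlinarith

theorem continuousOn_sq_div_one_add_mul_mul_sq {a : ℝ} (ha0 : 0 ≤ a) (ha1 : a < 27 / 4) :
    ContinuousOn (fun s : ℝ => (1 + s) ^ 2 / (1 + a * s * (1 + s) ^ 2))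
      (Set.Ioi (-(4 / 3))) :=
  ContinuousOn.div (by fun_prop) (by fun_prop)
    fun _ hs => (one_add_mul_mul_sq_pos ha0 ha1 hs).ne'

theorem intervalIntegrable_sq_div_one_add_mul_mul_sq {a x y : ℝ} (ha0 : 0 ≤ a)
    (ha1 : a < 27 / 4) (hx : -(4 / 3) < x) (hy : -(4 / 3) < y) :
    IntervalIntegrable (fun s : ℝ => (1 + s) ^ 2 / (1 + a * s * (1 + s) ^ 2))
      MeasureTheory.volume x y :=
  ((continuousOn_sq_div_one_add_mul_mul_sq ha0 ha1).mono
    (Set.ordConnected_Ioi.uIcc_subset hx hy)).intervalIntegrable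

theorem hasDerivAt_integral_sq_div_one_add_mul_mul_sq {a x : ℝ} (ha0 : 0 ≤ a)
    (ha1 : a < 27 / 4) (hx : -(4 / 3) < x) :
    HasDerivAt (fun y => ∫ s in (-1 : ℝ)..y, (1 + s) ^ 2 / (1 + a * s * (1 + s) ^ 2))
      ((1 + x) ^ 2 / (1 + a * x * (1 + x) ^ 2)) x :=
  have hc := continuousOn_sq_div_one_add_mul_mul_sq ha0 ha1
  intervalIntegral.integral_hasDerivAt_right
    (intervalIntegrable_sq_div_one_add_mul_mul_sq ha0 ha1 (by norm_num) hx)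
    (hc.stronglyMeasurableAtFilter isOpen_Ioi x hx)
    (hc.continuousAt (Ioi_mem_nhds hx))

/-- A solution of the comparison ODE `F' = -aF - 1/(1+F)²`, `F(0) = 0`,
staying above `-1` on `[0,T)`, cannot exist past the touchdown time
`t̄(a) = ∫₋₁⁰ ds/(as + 1/(1+s)²)`, i.e. `T ≤ t̄(a)`. -/
theorem ode_touchdown_time (a T : ℝ) (ha0 : 0 ≤ a) (ha1 : a < 27 / 4)
    (hT : 0 < T) (F : ℝ → ℝ) (hF0 : F 0 = 0)
    (hFgt : ∀ t ∈ Set.Ico (0 : ℝ) T, -1 < F t)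
    (hF : ∀ t ∈ Set.Ico (0 : ℝ) T,
      HasDerivWithinAt F (-a * F t - 1 / (1 + F t) ^ 2) (Set.Ico 0 T) t) :
    T ≤ ∫ s in (-1 : ℝ)..0, 1 / (a * s + 1 / (1 + s) ^ 2) := by
  have hint : ∫ s in (-1 : ℝ)..0, 1 / (a * s + 1 / (1 + s) ^ 2) =
      ∫ s in (-1 : ℝ)..0, (1 + s) ^ 2 / (1 + a * s * (1 + s) ^ 2) := by
    refine intervalIntegral.integral_congr_ae (Filter.Eventually.of_forall fun s hs => ?_)
    rw [Set.uIoc_of_le (by norm_num)] at hs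
    have h1 : 1 + s ≠ 0 := by linarith [hs.1]
    rw [show a * s + 1 / (1 + s) ^ 2 = (1 + a * s * (1 + s) ^ 2) / (1 + s) ^ 2 by
      field_simp; ring, one_div_div]
  rw [hint]
  set G : ℝ → ℝ := fun y => ∫ s in (-1 : ℝ)..y, (1 + s) ^ 2 / (1 + a * s * (1 + s) ^ 2)
  have hderiv : ∀ t ∈ Set.Ico (0 : ℝ) T,
      HasDerivWithinAt (fun t => G (F t) + t) 0 (Set.Ico 0 T) t := by
    intro t ht
    have hFt := hFgt t ht
    have h1 : 1 + F t ≠ 0 := by linarith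
    have h2 := (one_add_mul_mul_sq_pos ha0 ha1 (s := F t) (by linarith)).ne'
    have h := ((hasDerivAt_integral_sq_div_one_add_mul_mul_sq ha0 ha1
      (x := F t) (by linarith)).comp_hasDerivWithinAt t (hF t ht)).add (hasDerivWithinAt_id t _)
    refine HasDerivWithinAt.congr_deriv h ?_
    rw [div_mul_eq_mul_div, div_add' _ _ _ h2, div_eq_zero_iff]
    left
    field_simp
    ring
  refine le_of_forall_lt_imp_le_of_dense fun t htT => ?_
  rcases lt_or_ge t 0 with ht0 | ht0
  · refine ht0.le.trans (intervalIntegral.integral_nonneg (by norm_num) fun s hs => ?_)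
    exact div_nonneg (sq_nonneg _) (one_add_mul_mul_sq_pos ha0 ha1 (by linarith [hs.1])).le
  have hconst := (convex_Ico (0 : ℝ) T).norm_image_sub_le_of_norm_hasDerivWithin_le
    (C := 0) hderiv (fun _ _ => by simp) ⟨le_rfl, hT⟩ ⟨ht0, htT⟩
  rw [zero_mul, norm_le_zero_iff, hF0] at hconst
  have hpos : 0 ≤ G (F t) :=
    intervalIntegral.integral_nonneg (hFgt t ⟨ht0, htT⟩).le fun s hs =>
      div_nonneg (sq_nonneg _) (one_add_mul_mul_sq_pos ha0 ha1 (by linarith [hs.1])).le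
  change t ≤ G 0
  linarith
end

section
/- Define t̄ : [0, 27/4) → ℝ by t̄(a) = ∫_{-1}^{0} ds/(a·s + 1/(1+s)²). Then t̄(a) = 1/3 + a/30 + O(a²) as a → 0⁺; that is, the function a ↦ t̄(a) - 1/3 - a/30 is O(a²) as a tends to 0 from the right. -/
open Asymptotics

/-- The denominator `1 + a s (1+s)²` stays above `1/2` for `a ∈ [0, 1/2]` and `s ∈ [-1, 0]`. -/
lemma half_le_one_add_mul_sq {a s : ℝ} (ha0 : 0 ≤ a) (ha : a ≤ 1 / 2) (hs : s ∈ Set.Icc (-1 : ℝ) 0) :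
    1 / 2 ≤ 1 + a * s * (1 + s) ^ 2 := by
  obtain ⟨h1, h2⟩ := hs
  have hq : (1 + s) ^ 2 ≤ 1 := by nlinarith
  have hsq : -s * (1 + s) ^ 2 ≤ 1 := mul_le_one₀ (by linarith) (sq_nonneg _) hq
  nlinarith [mul_le_mul_of_nonneg_left hsq ha0]

/-- Second-order expansion in `a` of the integrand, with exact remainder. -/
lemma one_div_add_one_div_sq_expansion {a s : ℝ} (hs : 1 + s ≠ 0)
    (hd : 1 + a * s * (1 + s) ^ 2 ≠ 0) :
    1 / (a * s + 1 / (1 + s) ^ 2) = ((1 + s) ^ 2 - a * s * (1 + s) ^ 4) +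
      a ^ 2 * s ^ 2 * (1 + s) ^ 6 / (1 + a * s * (1 + s) ^ 2) := by
  have key : a * s + 1 / (1 + s) ^ 2 = (1 + a * s * (1 + s) ^ 2) / (1 + s) ^ 2 := by
    field_simp
    ring
  rw [key, one_div_div, div_eq_iff hd, add_mul, div_mul_cancel₀ _ hd]
  ring

lemma integral_sq_sub_mul_pow_four (a : ℝ) :
    ∫ s in (-1 : ℝ)..0, ((1 + s) ^ 2 - a * s * (1 + s) ^ 4) = 1 / 3 + a / 30 := by
  have hderiv : ∀ s ∈ Set.uIcc (-1 : ℝ) 0,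
      HasDerivAt (fun s : ℝ => (1 + s) ^ 3 / 3 - a * ((1 + s) ^ 6 / 6 - (1 + s) ^ 5 / 5))
        ((1 + s) ^ 2 - a * s * (1 + s) ^ 4) s := by
    intro s _
    have h1 : HasDerivAt (fun s : ℝ => 1 + s) 1 s := (hasDerivAt_id s).const_add 1
    refine (((h1.pow 3).div_const 3).sub
      ((((h1.pow 6).div_const 6).sub ((h1.pow 5).div_const 5)).const_mul a)).congr_deriv ?_
    norm_num
    ring
  rw [intervalIntegral.integral_eq_sub_of_hasDerivAt hderiv
    (Continuous.intervalIntegrable (by fun_prop) _ _)]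
  norm_num
  ring

/-- Asymptotics of the touchdown-time bound: with
`t̄(a) = ∫₋₁⁰ ds/(as + 1/(1+s)²)` for `a ∈ [0, 27/4)`, one has
`t̄(a) = 1/3 + a/30 + O(a²)` as `a → 0⁺`. -/
theorem tbar_asymptotics (tbar : ℝ → ℝ)
    (h : ∀ a ∈ Set.Ico (0 : ℝ) (27 / 4),
      tbar a = ∫ s in (-1 : ℝ)..0, 1 / (a * s + 1 / (1 + s) ^ 2)) :
    (fun a : ℝ => tbar a - 1 / 3 - a / 30)
      =O[nhdsWithin 0 (Set.Ioi 0)] (fun a : ℝ => a ^ 2) := by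
  refine IsBigO.of_bound 2 ?_
  filter_upwards [Ioo_mem_nhdsGT (show (0 : ℝ) < 1 / 2 by norm_num)] with a ⟨ha0, ha⟩
  have hden : ∀ s ∈ Set.Icc (-1 : ℝ) 0, 1 / 2 ≤ 1 + a * s * (1 + s) ^ 2 :=
    fun s hs => half_le_one_add_mul_sq ha0.le ha.le hs
  have hcongr : ∫ s in (-1 : ℝ)..0, 1 / (a * s + 1 / (1 + s) ^ 2) =
      ∫ s in (-1 : ℝ)..0, (((1 + s) ^ 2 - a * s * (1 + s) ^ 4) +
        a ^ 2 * s ^ 2 * (1 + s) ^ 6 / (1 + a * s * (1 + s) ^ 2)) := by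
    refine intervalIntegral.integral_congr_ae (Filter.Eventually.of_forall fun s hs => ?_)
    rw [Set.uIoc_of_le (by norm_num)] at hs
    have := hden s ⟨hs.1.le, hs.2⟩
    exact one_div_add_one_div_sq_expansion (by linarith [hs.1]) (by linarith)
  have hint : IntervalIntegrable
      (fun s : ℝ => a ^ 2 * s ^ 2 * (1 + s) ^ 6 / (1 + a * s * (1 + s) ^ 2))
      MeasureTheory.volume (-1) 0 := by
    refine ContinuousOn.intervalIntegrable (ContinuousOn.div (by fun_prop) (by fun_prop) ?_)
    intro s hs
    rw [Set.uIcc_of_le (by norm_num)] at hs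
    linarith [hden s hs]
  have hrem : ‖∫ s in (-1 : ℝ)..0, a ^ 2 * s ^ 2 * (1 + s) ^ 6 / (1 + a * s * (1 + s) ^ 2)‖
      ≤ 2 * a ^ 2 * |0 - (-1 : ℝ)| := by
    refine intervalIntegral.norm_integral_le_of_norm_le_const fun s hs => ?_
    rw [Set.uIoc_of_le (by norm_num)] at hs
    have hd := hden s ⟨hs.1.le, hs.2⟩
    have hs2 : s ^ 2 ≤ 1 := by nlinarith [hs.1, hs.2]
    have hs6 : (1 + s) ^ 6 ≤ 1 := pow_le_one₀ (by linarith [hs.1]) (by linarith [hs.2])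
    have hnum : s ^ 2 * (1 + s) ^ 6 ≤ 1 := mul_le_one₀ hs2 (by positivity) hs6
    rw [Real.norm_of_nonneg (by positivity), div_le_iff₀ (by linarith)]
    nlinarith [mul_le_mul_of_nonneg_left hnum (sq_nonneg a),
      mul_le_mul_of_nonneg_left hd (sq_nonneg a)]
  rw [h a ⟨ha0.le, by linarith⟩, hcongr,
    intervalIntegral.integral_add (Continuous.intervalIntegrable (by fun_prop) _ _) hint,
    integral_sq_sub_mul_pow_four, Real.norm_of_nonneg (sq_nonneg a)]
  norm_num at hrem ⊢
  convert hrem using 2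
  ring
end
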